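/- arXiv:2105.14691 — 3 statements merged into one kernel-verified Lean document; each statement's English description precedes it below -/
import Mathlib

section
/- The map Ψ defined by Ψ(N) = N Nᵀ is a homeomorphism from L^{n×p}_* onto S(n,p)*, where L^{n×p}_* carries the subspace topology from ℝ^{n×p} and S(n,p)* carries the subspace topology from ℝ^{n×n}; that is, Ψ is a continuous bijection from L^{n×p}_* onto S(n,p)* whose inverse (the reduced Cholesky map) is also continuous. -/
open Matrix BigOperators

/-- The first `p` columns of the square matrix `M` are linearly independent. -/
def FirstColsIndep (n p : ℕ) (M : Matrix (Fin n) (Fin n) ℝ) : Prop :=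
  LinearIndependent ℝ (fun j : {j : Fin n // (j : ℕ) < p} => (fun i : Fin n => M i j.1))

/-- Membership in `S(n,p)`: real `n×n` positive semidefinite of rank `p`. -/
def MemS (n p : ℕ) (M : Matrix (Fin n) (Fin n) ℝ) : Prop :=
  M.PosSemidef ∧ M.rank = p

/-- Membership in `S(n,p)*`: in `S(n,p)` with first `p` columns linearly independent. -/
def MemSStar (n p : ℕ) (M : Matrix (Fin n) (Fin n) ℝ) : Prop :=
  MemS n p M ∧ FirstColsIndep n p M

/-- `N` is mock lower triangular: `N i j = 0` whenever `i < j`. -/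
def MockLower (n p : ℕ) (N : Matrix (Fin n) (Fin p) ℝ) : Prop :=
  ∀ (i : Fin n) (j : Fin p), (i : ℕ) < (j : ℕ) → N i j = 0

/-- Membership in `L^{n×p}_*`: mock lower triangular with positive mock diagonal. -/
def MemL (n p : ℕ) (N : Matrix (Fin n) (Fin p) ℝ) : Prop :=
  MockLower n p N ∧ ∀ (i : Fin n) (j : Fin p), (i : ℕ) = (j : ℕ) → 0 < N i j

/-- Frobenius norm of a square matrix. -/
noncomputable def frobNorm (n : ℕ) (A : Matrix (Fin n) (Fin n) ℝ) : ℝ :=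
  Real.sqrt (∑ i : Fin n, ∑ j : Fin n, (A i j) ^ 2)

/-- The distance `d̃` on `L^{n×p}_*`. -/
noncomputable def dL (n p : ℕ) (N K : Matrix (Fin n) (Fin p) ℝ) : ℝ :=
  Real.sqrt ((∑ i : Fin n, ∑ j : Fin p, if (j : ℕ) < (i : ℕ) then (N i j - K i j) ^ 2 else 0)
    + ∑ i : Fin n, ∑ j : Fin p, if (i : ℕ) = (j : ℕ)
        then (Real.log (N i j) - Real.log (K i j)) ^ 2 else 0)

/-- The group operation `⊕` on `L^{n×p}_*`. -/
noncomputable def oplus (n p : ℕ) (N K : Matrix (Fin n) (Fin p) ℝ) : Matrix (Fin n) (Fin p) ℝ :=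
  fun i j => if (i : ℕ) = (j : ℕ) then N i j * K i j else N i j + K i j

/-- The identity `I_{n×p}` of `(L^{n×p}_*, ⊕)`. -/
noncomputable def oneL (n p : ℕ) : Matrix (Fin n) (Fin p) ℝ :=
  fun i j => if (i : ℕ) = (j : ℕ) then 1 else 0

/-- The `⊕`-inverse on `L^{n×p}_*`. -/
noncomputable def invL (n p : ℕ) (N : Matrix (Fin n) (Fin p) ℝ) : Matrix (Fin n) (Fin p) ℝ :=
  fun i j => if (i : ℕ) = (j : ℕ) then (N i j)⁻¹ else -(N i j)

/-- The geodesic `γ` of `d̃` joining `N` to `K`. -/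
noncomputable def geo (n p : ℕ) (N K : Matrix (Fin n) (Fin p) ℝ) (t : ℝ) :
    Matrix (Fin n) (Fin p) ℝ :=
  fun i j => if (i : ℕ) = (j : ℕ) then (N i j) ^ (1 - t) * (K i j) ^ t
    else (1 - t) * N i j + t * K i j

/-- The exponential map `Exp_N` on `L^{n×p}_*`. -/
noncomputable def expMap (n p : ℕ) (N X : Matrix (Fin n) (Fin p) ℝ) :
    Matrix (Fin n) (Fin p) ℝ :=
  fun i j => if (i : ℕ) = (j : ℕ) then N i j * Real.exp (X i j / N i j) else N i j + X i j

/-- The logarithm map `Log_N` on `L^{n×p}_*`. -/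
noncomputable def logMap (n p : ℕ) (N K : Matrix (Fin n) (Fin p) ℝ) :
    Matrix (Fin n) (Fin p) ℝ :=
  fun i j => if (i : ℕ) = (j : ℕ) then N i j * (Real.log (K i j) - Real.log (N i j))
    else K i j - N i j

open scoped MatrixOrder Matrix.Norms.L2Operator in
theorem Matrix.PosSemidef.exists_eq_transpose_mul_self {ι : Type*} [Fintype ι]
    {M : Matrix ι ι ℝ} (hM : M.PosSemidef) : ∃ C : Matrix ι ι ℝ, M = Cᵀ * C := by
  classical
  obtain ⟨C, hC⟩ := CStarAlgebra.nonneg_iff_eq_star_mul_self.mp hM.nonneg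
  exact ⟨C, by rwa [star_eq_conjTranspose, conjTranspose_eq_transpose_of_trivial] at hC⟩

theorem Orthonormal.inner_eq_sum_of_mem_span {E ι : Type*} [NormedAddCommGroup E]
    [InnerProductSpace ℝ E] [Fintype ι] {e : ι → E} (he : Orthonormal ℝ e) (x : E) {y : E}
    (hy : y ∈ Submodule.span ℝ (Set.range e)) :
    inner ℝ x y = ∑ k, inner ℝ (e k) x * inner ℝ (e k) y := by
  obtain ⟨a, rfl⟩ := (Submodule.mem_span_range_iff_exists_fun ℝ).1 hy
  simp_rw [he.inner_right_fintype, inner_sum, inner_smul_right, real_inner_comm x, mul_comm]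

theorem InnerProductSpace.inner_gramSchmidtNormed_of_lt {E ι : Type*} [NormedAddCommGroup E]
    [InnerProductSpace ℝ E] [LinearOrder ι] [LocallyFiniteOrderBot ι] [WellFoundedLT ι]
    (f : ι → E) {i j : ι} (hij : i < j) : inner ℝ (gramSchmidtNormed ℝ f j) (f i) = 0 := by
  simp [gramSchmidtNormed, inner_smul_left, gramSchmidt_inv_triangular ℝ f hij]

theorem InnerProductSpace.inner_gramSchmidtNormed_self_pos {E ι : Type*} [NormedAddCommGroup E]
    [InnerProductSpace ℝ E] [LinearOrder ι] [LocallyFiniteOrderBot ι] [WellFoundedLT ι]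
    {f : ι → E} (hf : LinearIndependent ℝ f) (j : ι) :
    0 < inner ℝ (gramSchmidtNormed ℝ f j) (f j) := by
  have hne := gramSchmidt_ne_zero (𝕜 := ℝ) j hf
  have h : inner ℝ (gramSchmidt ℝ f j) (f j) = ‖gramSchmidt ℝ f j‖ ^ 2 := by
    conv_lhs => rw [gramSchmidt_def'' ℝ f j]
    rw [inner_add_right, inner_sum, Finset.sum_eq_zero, add_zero, real_inner_self_eq_norm_sq]
    intro k hk
    rw [inner_smul_right, gramSchmidt_orthogonal ℝ f (Finset.mem_Iio.1 hk).ne', mul_zero]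
  have hpos := norm_pos_iff.2 hne
  simp only [gramSchmidtNormed, inner_smul_left, h]
  simp only [RCLike.ofReal_real_eq_id, id_eq, conj_trivial]
  positivity

section

variable {n p : ℕ}

/-- The index equivalence between the first `p` elements of `Fin n` and `Fin p`. -/
def firstIndexEquiv (h : p ≤ n) : Fin p ≃ {j : Fin n // (j : ℕ) < p} where
  toFun j := ⟨Fin.castLE h j, j.2⟩
  invFun j := ⟨j.1, j.2⟩
  left_inv _ := rfl
  right_inv _ := rfl

theorem firstColsIndep_iff (h : p ≤ n) (M : Matrix (Fin n) (Fin n) ℝ) :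
    FirstColsIndep n p M ↔ LinearIndependent ℝ fun j : Fin p => M.col (Fin.castLE h j) :=
  (linearIndependent_equiv (firstIndexEquiv h)).symm

theorem MemL.apply_castLE_eq_zero {N : Matrix (Fin n) (Fin p) ℝ} (hN : MemL n p N) (h : p ≤ n)
    {j k : Fin p} (hjk : j < k) : N (Fin.castLE h j) k = 0 :=
  hN.1 _ _ hjk

theorem MemL.diag_pos {N : Matrix (Fin n) (Fin p) ℝ} (hN : MemL n p N) (h : p ≤ n)
    (j : Fin p) : 0 < N (Fin.castLE h j) j :=
  hN.2 _ _ rfl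

theorem MemL.mul_transpose_apply {N : Matrix (Fin n) (Fin p) ℝ} (hN : MemL n p N) (h : p ≤ n)
    (i : Fin n) (j : Fin p) :
    (N * Nᵀ) i (Fin.castLE h j) =
      ∑ k ∈ Finset.Iio j, N i k * N (Fin.castLE h j) k + N i j * N (Fin.castLE h j) j := by
  rw [Matrix.mul_apply, add_comm,
    ← Finset.sum_insert (f := fun k => N i k * N (Fin.castLE h j) k) (by simp)]
  refine (Finset.sum_subset (Finset.subset_univ _) fun k _ hk => ?_).symm
  have hjk : j < k := by
    simp only [Finset.mem_insert, Finset.mem_Iio, not_or, not_lt] at hk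
    exact lt_of_le_of_ne hk.2 (Ne.symm hk.1)
  simp [hN.apply_castLE_eq_zero h hjk]

theorem MemL.diag_eq {N : Matrix (Fin n) (Fin p) ℝ} (hN : MemL n p N) (h : p ≤ n) (j : Fin p) :
    N (Fin.castLE h j) j =
      √((N * Nᵀ) (Fin.castLE h j) (Fin.castLE h j) -
        ∑ k ∈ Finset.Iio j, N (Fin.castLE h j) k * N (Fin.castLE h j) k) := by
  rw [hN.mul_transpose_apply h, add_sub_cancel_left, Real.sqrt_mul_self (hN.diag_pos h j).le]

theorem MemL.apply_eq {N : Matrix (Fin n) (Fin p) ℝ} (hN : MemL n p N) (h : p ≤ n)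
    (i : Fin n) (j : Fin p) :
    N i j = ((N * Nᵀ) i (Fin.castLE h j) - ∑ k ∈ Finset.Iio j, N i k * N (Fin.castLE h j) k) /
      N (Fin.castLE h j) j := by
  rw [hN.mul_transpose_apply h, add_sub_cancel_left, mul_div_cancel_right₀ _ (hN.diag_pos h j).ne']

theorem MemL.eq_of_mul_transpose_eq {N K : Matrix (Fin n) (Fin p) ℝ} (hN : MemL n p N)
    (hK : MemL n p K) (h : p ≤ n) (hNK : N * Nᵀ = K * Kᵀ) : N = K := by
  suffices ∀ j i, N i j = K i j from Matrix.ext fun i j => this j i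
  intro j
  induction j using WellFoundedLT.induction with
  | ind j ih =>
    have hsum (i : Fin n) : ∑ k ∈ Finset.Iio j, N i k * N (Fin.castLE h j) k =
        ∑ k ∈ Finset.Iio j, K i k * K (Fin.castLE h j) k :=
      Finset.sum_congr rfl fun k hk => by
        rw [ih k (Finset.mem_Iio.1 hk), ih k (Finset.mem_Iio.1 hk)]
    have hdiag : N (Fin.castLE h j) j = K (Fin.castLE h j) j := by
      rw [hN.diag_eq h, hK.diag_eq h, hsum, hNK]
    intro i
    rw [hN.apply_eq h, hK.apply_eq h, hsum, hNK, hdiag]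

theorem MemL.continuous_of_continuous_mul_transpose {X : Type*} [TopologicalSpace X] (h : p ≤ n)
    {f : X → Matrix (Fin n) (Fin p) ℝ} (hf : ∀ x, MemL n p (f x))
    (hc : Continuous fun x => f x * (f x)ᵀ) : Continuous f := by
  suffices ∀ j i, Continuous fun x => f x i j from continuous_matrix fun i j => this j i
  intro j
  induction j using WellFoundedLT.induction with
  | ind j ih =>
    have hsum (i : Fin n) :
        Continuous fun x => ∑ k ∈ Finset.Iio j, f x i k * f x (Fin.castLE h j) k :=
      continuous_finsetSum _ fun k hk =>
        (ih k (Finset.mem_Iio.1 hk) _).mul (ih k (Finset.mem_Iio.1 hk) _)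
    have hdiag : Continuous fun x => f x (Fin.castLE h j) j :=
      (((hc.matrix_elem _ _).sub (hsum _)).sqrt).congr fun x => ((hf x).diag_eq h j).symm
    intro i
    exact (((hc.matrix_elem _ _).sub (hsum i)).div hdiag fun x => ((hf x).diag_pos h j).ne').congr
      fun x => ((hf x).apply_eq h i j).symm

theorem MemL.firstColsIndep_mul_transpose {N : Matrix (Fin n) (Fin p) ℝ} (hN : MemL n p N)
    (h : p ≤ n) : FirstColsIndep n p (N * Nᵀ) := by
  rw [firstColsIndep_iff h]
  let L : Matrix (Fin p) (Fin p) ℝ := N.submatrix (Fin.castLE h) id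
  have hL : L.det ≠ 0 := by
    rw [Matrix.det_of_isLowerTriangular L fun j k hjk => hN.apply_castLE_eq_zero h hjk]
    exact Finset.prod_ne_zero_iff.2 fun j _ => (hN.diag_pos h j).ne'
  have hLL : LinearIndependent ℝ (L * Lᵀ).col := by
    rw [Matrix.linearIndependent_cols_iff_isUnit, Matrix.isUnit_iff_isUnit_det, Matrix.det_mul,
      Matrix.det_transpose]
    exact (mul_ne_zero hL hL).isUnit
  exact LinearIndependent.of_comp (LinearMap.funLeft ℝ ℝ (Fin.castLE h)) hLL

theorem FirstColsIndep.le_rank {M : Matrix (Fin n) (Fin n) ℝ} (hM : FirstColsIndep n p M)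
    (h : p ≤ n) : p ≤ M.rank := by
  have hM' := (firstColsIndep_iff h M).1 hM
  rw [Matrix.rank_eq_finrank_span_cols]
  calc p = Module.finrank ℝ
        (Submodule.span ℝ (Set.range fun j : Fin p => M.col (Fin.castLE h j))) := by
        rw [finrank_span_eq_card hM', Fintype.card_fin]
    _ ≤ _ := Submodule.finrank_mono <| Submodule.span_mono <|
        Set.range_subset_iff.2 fun j => Set.mem_range_self _

theorem MemL.memSStar_mul_transpose {N : Matrix (Fin n) (Fin p) ℝ} (hN : MemL n p N)
    (h : p ≤ n) : MemSStar n p (N * Nᵀ) := by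
  have hind := hN.firstColsIndep_mul_transpose h
  refine ⟨⟨?_, le_antisymm ?_ (hind.le_rank h)⟩, hind⟩
  · simpa using Matrix.posSemidef_self_mul_conjTranspose N
  · exact (Matrix.rank_mul_le_left _ _).trans (Matrix.rank_le_width N)

theorem MemSStar.exists_memL {M : Matrix (Fin n) (Fin n) ℝ} (hM : MemSStar n p M) (h : p ≤ n) :
    ∃ N, MemL n p N ∧ N * Nᵀ = M := by
  obtain ⟨⟨hpos, hrank⟩, hind⟩ := hM
  obtain ⟨C, rfl⟩ := hpos.exists_eq_transpose_mul_self
  rw [firstColsIndep_iff h] at hind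
  let φ : (Fin n → ℝ) ≃ₗ[ℝ] EuclideanSpace ℝ (Fin n) := (WithLp.linearEquiv 2 ℝ (Fin n → ℝ)).symm
  let c : Fin n → EuclideanSpace ℝ (Fin n) := fun i => φ (C.col i)
  let f : Fin p → EuclideanSpace ℝ (Fin n) := c ∘ Fin.castLE h
  have hc (i j : Fin n) : inner ℝ (c i) (c j) = (Cᵀ * C) i j := by
    rw [Matrix.mul_apply]
    change C.col j ⬝ᵥ star (C.col i) = _
    simp [dotProduct, mul_comm]
  have hCcol : LinearIndependent ℝ fun j : Fin p => C.col (Fin.castLE h j) :=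
    LinearIndependent.of_comp Cᵀ.mulVecLin hind
  have hf : LinearIndependent ℝ f := hCcol.map' φ.toLinearMap φ.ker
  have hspan : Submodule.span ℝ (Set.range f) = Submodule.span ℝ (Set.range c) := by
    refine Submodule.eq_of_le_of_finrank_eq
      (Submodule.span_mono (Set.range_comp_subset_range _ _)) ?_
    rw [finrank_span_eq_card hf, Fintype.card_fin]
    have hcr : Submodule.span ℝ (Set.range c) =
        (Submodule.span ℝ (Set.range C.col)).map (φ : (Fin n → ℝ) →ₗ[ℝ] _) := by
      rw [Submodule.map_span, ← Set.range_comp]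
      rfl
    rw [hcr, LinearEquiv.finrank_map_eq, ← Matrix.rank_eq_finrank_span_cols,
      ← Matrix.rank_transpose_mul_self, hrank]
  have hmem (i : Fin n) :
      c i ∈ Submodule.span ℝ (Set.range (InnerProductSpace.gramSchmidtNormed ℝ f)) := by
    rw [InnerProductSpace.span_gramSchmidtNormed_range, InnerProductSpace.span_gramSchmidt, hspan]
    exact Submodule.subset_span (Set.mem_range_self i)
  refine ⟨Matrix.of fun i j => inner ℝ (InnerProductSpace.gramSchmidtNormed ℝ f j) (c i),
    ⟨fun i j hij => ?_, fun i j hij => ?_⟩, ?_⟩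
  · exact InnerProductSpace.inner_gramSchmidtNormed_of_lt f (i := ⟨i, hij.trans j.2⟩) hij
  · obtain rfl : i = Fin.castLE h j := Fin.ext hij
    exact InnerProductSpace.inner_gramSchmidtNormed_self_pos hf j
  · ext i j
    rw [← hc, (InnerProductSpace.gramSchmidtNormed_orthonormal hf).inner_eq_sum_of_mem_span _
      (hmem j), Matrix.mul_apply]
    rfl

/-- The map `N ↦ N Nᵀ` as an equivalence from `L^{n×p}_*` onto `S(n,p)*`. -/
noncomputable def reducedCholeskyEquiv (h : p ≤ n) :
    {N : Matrix (Fin n) (Fin p) ℝ // MemL n p N} ≃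
      {M : Matrix (Fin n) (Fin n) ℝ // MemSStar n p M} :=
  Equiv.ofBijective (fun N => ⟨N.1 * N.1ᵀ, N.2.memSStar_mul_transpose h⟩)
    ⟨fun N K hNK => Subtype.ext (N.2.eq_of_mul_transpose_eq K.2 h (congrArg Subtype.val hNK)),
      fun M => by
        obtain ⟨N, hN, hNM⟩ := M.2.exists_memL h
        exact ⟨⟨N, hN⟩, Subtype.ext hNM⟩⟩

theorem continuous_reducedCholeskyEquiv_symm (h : p ≤ n) :
    Continuous (reducedCholeskyEquiv h).symm := by
  refine Continuous.subtype_mk (MemL.continuous_of_continuous_mul_transpose h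
    (fun M => ((reducedCholeskyEquiv h).symm M).2) ?_) _
  exact continuous_subtype_val.congr fun M =>
    (congrArg Subtype.val ((reducedCholeskyEquiv h).apply_symm_apply M)).symm

end

/-- `Ψ(N) = N Nᵀ` is a homeomorphism from `L^{n×p}_*` onto `S(n,p)*`. -/
theorem stmt4 (n p : ℕ) (hp : 1 ≤ p) (hpn : p < n) :
    ∃ Φ : {N : Matrix (Fin n) (Fin p) ℝ // MemL n p N} ≃ₜ
          {M : Matrix (Fin n) (Fin n) ℝ // MemSStar n p M},
      ∀ N : {N : Matrix (Fin n) (Fin p) ℝ // MemL n p N},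
        (Φ N).1 = N.1 * (N.1)ᵀ := by
  refine ⟨⟨reducedCholeskyEquiv hpn.le, ?_, continuous_reducedCholeskyEquiv_symm hpn.le⟩,
    fun _ => rfl⟩
  exact (continuous_subtype_val.matrix_mul
    continuous_subtype_val.matrix_transpose).subtype_mk _
end

section
/- Let P, Q ∈ S(n,p)* with reduced Cholesky factors N and K, and for t ∈ ℝ let γ(t) ∈ L^{n×p}_* be given by γ(t)_{ii} = N_{ii}^{1−t} K_{ii}^{t} for i = 1,…,p and γ(t)_{ij} = (1−t)N_{ij} + t K_{ij} for i > j. Then the curve Γ(t) = γ(t)γ(t)ᵀ satisfies Γ(t) ∈ S(n,p)* for all t ∈ ℝ, Γ(0) = P, Γ(1) = Q, and d(Γ(s), Γ(t)) = |s − t| · d(P, Q) for all s, t ∈ ℝ, where d(P,Q) = d̃(N,K). -/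
open Matrix BigOperators

theorem MemL.isUnit_submatrix {n p : ℕ} (h : p ≤ n) {N : Matrix (Fin n) (Fin p) ℝ}
    (hN : MemL n p N) : IsUnit (N.submatrix (Fin.castLE h) id) := by
  rw [isUnit_iff_isUnit_det, isUnit_iff_ne_zero, det_of_isLowerTriangular]
  · exact Finset.prod_ne_zero_iff.mpr fun i _ => (hN.2 _ i rfl).ne'
  · exact fun i j hij => hN.1 _ _ hij

theorem MemL.rank_eq {n p : ℕ} (h : p ≤ n) {N : Matrix (Fin n) (Fin p) ℝ}
    (hN : MemL n p N) : N.rank = p := by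
  refine le_antisymm (by simpa using N.rank_le_card_width) ?_
  have hr := rank_of_isUnit _ (hN.isUnit_submatrix h)
  rw [Fintype.card_fin] at hr
  exact hr.ge.trans (rank_submatrix_le _ _ _)

theorem MemL.firstColsIndep {n p : ℕ} (h : p ≤ n) {N : Matrix (Fin n) (Fin p) ℝ}
    (hN : MemL n p N) : FirstColsIndep n p (N * Nᵀ) := by
  let T := N.submatrix (Fin.castLE h) id
  have hu : IsUnit (T * Tᵀ) :=
    (hN.isUnit_submatrix h).mul ((isUnit_transpose _).mpr (hN.isUnit_submatrix h))
  have hcols := linearIndependent_cols_of_isUnit hu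
  refine LinearIndependent.of_comp (LinearMap.funLeft ℝ ℝ (Fin.castLE h)) ?_
  exact hcols.comp (fun j : {j : Fin n // (j : ℕ) < p} => (⟨j.1, j.2⟩ : Fin p))
    fun a b hab => Subtype.ext (Fin.ext (Fin.mk.inj hab))

theorem MemL.memSStar {n p : ℕ} (h : p ≤ n) {N : Matrix (Fin n) (Fin p) ℝ}
    (hN : MemL n p N) : MemSStar n p (N * Nᵀ) := by
  refine ⟨⟨?_, ?_⟩, hN.firstColsIndep h⟩
  · simpa using posSemidef_self_mul_conjTranspose N
  · rw [rank_self_mul_transpose, hN.rank_eq h]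

theorem MemL.geo {n p : ℕ} {N K : Matrix (Fin n) (Fin p) ℝ} (hN : MemL n p N)
    (hK : MemL n p K) (t : ℝ) : MemL n p (geo n p N K t) := by
  refine ⟨fun i j hij => ?_, fun i j hij => ?_⟩
  · simp [_root_.geo, hij.ne, hN.1 i j hij, hK.1 i j hij]
  · have := hN.2 i j hij
    have := hK.2 i j hij
    simp only [_root_.geo, hij, if_true]
    positivity

theorem geo_zero (n p : ℕ) (N K : Matrix (Fin n) (Fin p) ℝ) : geo n p N K 0 = N := by
  ext i j
  simp [geo]

theorem geo_one (n p : ℕ) (N K : Matrix (Fin n) (Fin p) ℝ) : geo n p N K 1 = K := by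
  ext i j
  simp [geo]

theorem dL_geo {n p : ℕ} {N K : Matrix (Fin n) (Fin p) ℝ} (hN : MemL n p N)
    (hK : MemL n p K) (s t : ℝ) :
    dL n p (geo n p N K s) (geo n p N K t) = |s - t| * dL n p N K := by
  have hlog (i : Fin n) (j : Fin p) (hij : (i : ℕ) = j) (r : ℝ) :
      Real.log (N i j ^ (1 - r) * K i j ^ r) =
        (1 - r) * Real.log (N i j) + r * Real.log (K i j) := by
    have h1 := hN.2 i j hij
    have h2 := hK.2 i j hij
    rw [Real.log_mul (Real.rpow_pos_of_pos h1 _).ne' (Real.rpow_pos_of_pos h2 _).ne',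
      Real.log_rpow h1, Real.log_rpow h2]
  rw [dL, dL, ← Real.sqrt_sq_eq_abs, ← Real.sqrt_mul (sq_nonneg _), mul_add]
  simp only [Finset.mul_sum]
  congr 2 <;> refine Finset.sum_congr rfl fun i _ => Finset.sum_congr rfl fun j _ => ?_
  · split_ifs with hij
    · simp only [geo, hij.ne', if_false]
      ring
    · simp
  · split_ifs with hij
    · simp only [geo, if_pos hij, hlog i j hij]
      ring
    · simp

/-- `Γ(t) = γ(t)γ(t)ᵀ` is a constant-speed geodesic of `d` joining `P` to `Q`
in `S(n,p)*`, where `γ` joins the reduced Cholesky factors `N` of `P` and `K` of `Q`. -/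
theorem stmt12 (n p : ℕ) (hp : 1 ≤ p) (hpn : p < n)
    (P Q : Matrix (Fin n) (Fin n) ℝ) (hP : MemSStar n p P) (hQ : MemSStar n p Q)
    (N K : Matrix (Fin n) (Fin p) ℝ) (hN : MemL n p N) (hK : MemL n p K)
    (hPN : P = N * Nᵀ) (hQK : Q = K * Kᵀ) :
    (∀ t : ℝ, MemSStar n p (geo n p N K t * (geo n p N K t)ᵀ)) ∧
    geo n p N K 0 * (geo n p N K 0)ᵀ = P ∧
    geo n p N K 1 * (geo n p N K 1)ᵀ = Q ∧
    (∀ s t : ℝ, dL n p (geo n p N K s) (geo n p N K t) = |s - t| * dL n p N K) := by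
  refine ⟨fun t => (hN.geo hK t).memSStar hpn.le, ?_, ?_, dL_geo hN hK⟩
  · rw [geo_zero, hPN]
  · rw [geo_one, hQK]
end

section
/- Let N_1, …, N_k ∈ L^{n×p}_* and let w_1, …, w_k be positive reals with w_1 + ⋯ + w_k = 1. Then the function Z ↦ Σ_{l=1}^k w_l · d̃(Z, N_l)² on L^{n×p}_* attains a unique global minimum, at the point F_w ∈ L^{n×p}_* given by (F_w)_{ii} = Π_{l=1}^k (N_l)_{ii}^{w_l} for i = 1,…,p and (F_w)_{ij} = Σ_{l=1}^k w_l (N_l)_{ij} for i > j. -/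
open Matrix BigOperators

/-- The weighted Fréchet mean candidate in `L^{n×p}_*`: weighted geometric mean on the
mock diagonal and weighted arithmetic mean below it. -/
noncomputable def frechetW (n p k : ℕ) (N : Fin k → Matrix (Fin n) (Fin p) ℝ)
    (w : Fin k → ℝ) : Matrix (Fin n) (Fin p) ℝ :=
  fun i j => if (i : ℕ) = (j : ℕ) then ∏ l : Fin k, (N l i j) ^ (w l)
    else ∑ l : Fin k, w l * N l i j

/-- Global coordinates on `L^{n×p}_*`: the entries below the mock diagonal and the logarithms
of the entries on it. -/
noncomputable def logCoord (n p : ℕ) (N : Matrix (Fin n) (Fin p) ℝ) : Matrix (Fin n) (Fin p) ℝ :=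
  fun i j => if (i : ℕ) = (j : ℕ) then Real.log (N i j)
    else if (j : ℕ) < (i : ℕ) then N i j else 0

theorem dL_sq (n p : ℕ) (N K : Matrix (Fin n) (Fin p) ℝ) :
    dL n p N K ^ 2 = ∑ i, ∑ j, (logCoord n p N i j - logCoord n p K i j) ^ 2 := by
  rw [dL, Real.sq_sqrt]
  · simp only [← Finset.sum_add_distrib]
    refine Finset.sum_congr rfl fun i _ => Finset.sum_congr rfl fun j _ => ?_
    unfold logCoord
    split_ifs <;> first | omega | simp
  · refine add_nonneg ?_ ?_ <;>
    · refine Finset.sum_nonneg fun i _ => Finset.sum_nonneg fun j _ => ?_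
      split_ifs <;> positivity

theorem logCoord_injOn (n p : ℕ) : Set.InjOn (logCoord n p) {N | MemL n p N} := by
  intro N hN K hK h
  ext i j
  have hij := congrFun (congrFun h i) j
  unfold logCoord at hij
  split_ifs at hij with h₁ h₂
  · exact Real.log_injOn_pos (hN.2 i j h₁) (hK.2 i j h₁) hij
  · exact hij
  · rw [hN.1 i j (by omega), hK.1 i j (by omega)]

theorem eq_of_dL_sq_eq_zero {n p : ℕ} {N K : Matrix (Fin n) (Fin p) ℝ}
    (hN : MemL n p N) (hK : MemL n p K) (h : dL n p N K ^ 2 = 0) : N = K := by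
  refine logCoord_injOn n p hN hK ?_
  ext i j
  rw [dL_sq, Finset.sum_eq_zero_iff_of_nonneg
    fun i _ => Finset.sum_nonneg fun j _ => sq_nonneg _] at h
  have hi := h i (Finset.mem_univ i)
  rw [Finset.sum_eq_zero_iff_of_nonneg fun j _ => sq_nonneg _] at hi
  exact sub_eq_zero.mp (pow_eq_zero_iff two_ne_zero |>.mp (hi j (Finset.mem_univ j)))

theorem memL_frechetW {n p k : ℕ} {N : Fin k → Matrix (Fin n) (Fin p) ℝ}
    (hN : ∀ l, MemL n p (N l)) (w : Fin k → ℝ) : MemL n p (frechetW n p k N w) := by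
  refine ⟨fun i j hij => ?_, fun i j hij => ?_⟩
  · rw [frechetW, if_neg hij.ne]
    exact Finset.sum_eq_zero fun l _ => by rw [(hN l).1 i j hij, mul_zero]
  · rw [frechetW, if_pos hij]
    exact Finset.prod_pos fun l _ => Real.rpow_pos_of_pos ((hN l).2 i j hij) _

theorem logCoord_frechetW {n p k : ℕ} {N : Fin k → Matrix (Fin n) (Fin p) ℝ}
    (hN : ∀ l, MemL n p (N l)) (w : Fin k → ℝ) (i : Fin n) (j : Fin p) :
    logCoord n p (frechetW n p k N w) i j = ∑ l, w l * logCoord n p (N l) i j := by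
  unfold logCoord frechetW
  split_ifs with h
  · rw [Real.log_prod fun l _ => (Real.rpow_pos_of_pos ((hN l).2 i j h) _).ne']
    exact Finset.sum_congr rfl fun l _ => Real.log_rpow ((hN l).2 i j h) _
  · rfl
  · simp

theorem sum_mul_sub_sq_eq {ι : Type*} [Fintype ι] {w : ι → ℝ} (hsum : ∑ l, w l = 1)
    (x : ι → ℝ) (z : ℝ) :
    ∑ l, w l * (z - x l) ^ 2
      = (z - ∑ l, w l * x l) ^ 2 + ∑ l, w l * (∑ m, w m * x m - x l) ^ 2 := by
  set a := ∑ l, w l * x l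
  have expand (y : ℝ) : ∑ l, w l * (y - x l) ^ 2 = y ^ 2 - 2 * y * a + ∑ l, w l * x l ^ 2 := by
    calc ∑ l, w l * (y - x l) ^ 2
        = ∑ l, (y ^ 2 * w l - 2 * y * (w l * x l) + w l * x l ^ 2) :=
          Finset.sum_congr rfl fun l _ => by ring
      _ = y ^ 2 - 2 * y * a + ∑ l, w l * x l ^ 2 := by
          rw [Finset.sum_add_distrib, Finset.sum_sub_distrib, ← Finset.mul_sum,
            ← Finset.mul_sum, hsum, mul_one]
  rw [expand z, expand a]
  ring

theorem sum_mul_dL_sq_eq {n p k : ℕ} {N : Fin k → Matrix (Fin n) (Fin p) ℝ}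
    (hN : ∀ l, MemL n p (N l)) {w : Fin k → ℝ} (hsum : ∑ l, w l = 1)
    (Z : Matrix (Fin n) (Fin p) ℝ) :
    ∑ l, w l * dL n p Z (N l) ^ 2
      = dL n p Z (frechetW n p k N w) ^ 2 + ∑ l, w l * dL n p (frechetW n p k N w) (N l) ^ 2 := by
  have swap (Y : Matrix (Fin n) (Fin p) ℝ) : ∑ l, w l * dL n p Y (N l) ^ 2
      = ∑ i, ∑ j, ∑ l, w l * (logCoord n p Y i j - logCoord n p (N l) i j) ^ 2 := by
    simp only [dL_sq, Finset.mul_sum]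
    rw [Finset.sum_comm]
    exact Finset.sum_congr rfl fun i _ => Finset.sum_comm
  rw [swap, swap, dL_sq]
  simp only [← Finset.sum_add_distrib, logCoord_frechetW hN]
  exact Finset.sum_congr rfl fun i _ => Finset.sum_congr rfl fun j _ =>
    sum_mul_sub_sq_eq hsum _ _

/-- the weighted Fréchet functional on `L^{n×p}_*` attains a unique global
minimum at `frechetW`. -/
theorem stmt15 (n p k : ℕ) (hk : 0 < k)
    (N : Fin k → Matrix (Fin n) (Fin p) ℝ) (hN : ∀ l, MemL n p (N l))
    (w : Fin k → ℝ) (hw : ∀ l, 0 < w l) (hsum : ∑ l : Fin k, w l = 1) :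
    MemL n p (frechetW n p k N w) ∧
    (∀ Z, MemL n p Z →
      ∑ l : Fin k, w l * (dL n p (frechetW n p k N w) (N l)) ^ 2
        ≤ ∑ l : Fin k, w l * (dL n p Z (N l)) ^ 2) ∧
    (∀ Z, MemL n p Z →
      (∑ l : Fin k, w l * (dL n p Z (N l)) ^ 2
        = ∑ l : Fin k, w l * (dL n p (frechetW n p k N w) (N l)) ^ 2) →
      Z = frechetW n p k N w) := by
  have hF := memL_frechetW hN w
  refine ⟨hF, fun Z _ => ?_, fun Z hZ h => ?_⟩
  · rw [sum_mul_dL_sq_eq hN hsum Z]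
    exact le_add_of_nonneg_left (sq_nonneg _)
  · rw [sum_mul_dL_sq_eq hN hsum Z, add_eq_right] at h
    exact eq_of_dL_sq_eq_zero hZ hF h
end
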